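/- (⟨NE⟩ ⊗ id_V) ∘ (id_V ⊗ ⟨Cup⟩) = (id_V ⊗ ⟨NW⟩) ∘ (⟨Cup⟩ ⊗ id_V) as K-linear maps V → V ⊗ V ⊗ V (identifying V ⊗ K ≅ V ≅ K ⊗ V). This is the Kauffman-amplitude identity corresponding to the Yetter Ψ move, i.e. the source [1,Cup,0][0,NE,1] and target [0,Cup,1][1,NW,0] of the elementary transition ET4I have equal Kauffman amplitudes (a still's amplitude is composed contravariantly, bottom framed event first). -/

import Mathlib

set_option synthInstance.maxHeartbeats 1000000
set_option maxHeartbeats 1000000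

noncomputable section

open TensorProduct

/-- The ground field `K = ℚ(q)`. -/
abbrev K : Type := RatFunc ℚ

/-- The 2-dimensional `K`-vector space `V` with basis `e 0, e 1`. -/
abbrev V : Type := Fin 2 → K

/-- The indeterminate `q`. -/
noncomputable def q : K := RatFunc.X

/-- The basis vectors `e₀, e₁` of `V`. -/
noncomputable def e : Fin 2 → V := fun i => Pi.single i (1 : K)

/-- The standard basis of `V`. -/
noncomputable def Vbasis : Module.Basis (Fin 2) K V := Pi.basisFun K (Fin 2)

/-- The induced basis `e i ⊗ e j` of `V ⊗ V`. -/
noncomputable def VVbasis : Module.Basis (Fin 2 × Fin 2) K (V ⊗[K] V) :=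
  Vbasis.tensorProduct Vbasis

/-- Kauffman amplitude of `Cup`: `1 ↦ -q·e₀⊗e₁ + q⁻¹·e₁⊗e₀`. -/
noncomputable def Cup : K →ₗ[K] V ⊗[K] V :=
  LinearMap.toSpanSingleton K (V ⊗[K] V)
    ((-q) • (e 0 ⊗ₜ[K] e 1) + q⁻¹ • (e 1 ⊗ₜ[K] e 0))

/-- Kauffman amplitude of `Cap`: `e₀⊗e₀ ↦ 0`, `e₁⊗e₁ ↦ 0`, `e₀⊗e₁ ↦ q`, `e₁⊗e₀ ↦ -q⁻¹`. -/
noncomputable def Cap : V ⊗[K] V →ₗ[K] K :=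
  VVbasis.constr K fun p =>
    if p = (0, 1) then q else if p = (1, 0) then -q⁻¹ else 0

/-- Kauffman amplitude of `NE`. -/
noncomputable def NE : V ⊗[K] V →ₗ[K] V ⊗[K] V :=
  VVbasis.constr K fun p =>
    if p = (0, 0) then q • (e 0 ⊗ₜ[K] e 0)
    else if p = (1, 1) then q • (e 1 ⊗ₜ[K] e 1)
    else if p = (0, 1) then q⁻¹ • (e 1 ⊗ₜ[K] e 0)
    else q⁻¹ • (e 0 ⊗ₜ[K] e 1) + (q - q⁻¹ ^ 3) • (e 1 ⊗ₜ[K] e 0)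

/-- Kauffman amplitude of `NW`. -/
noncomputable def NW : V ⊗[K] V →ₗ[K] V ⊗[K] V :=
  VVbasis.constr K fun p =>
    if p = (0, 0) then q⁻¹ • (e 0 ⊗ₜ[K] e 0)
    else if p = (1, 1) then q⁻¹ • (e 1 ⊗ₜ[K] e 1)
    else if p = (1, 0) then q • (e 0 ⊗ₜ[K] e 1)
    else (q⁻¹ - q ^ 3) • (e 0 ⊗ₜ[K] e 1) + q • (e 1 ⊗ₜ[K] e 0)

theorem aux0 {F M : Type*} [Field F] [AddCommGroup M] [Module F M] (a : F) (x y : M) :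
    (-a) • a • x + a⁻¹ • a⁻¹ • y = a • (-a) • x + a⁻¹ • a⁻¹ • y := by
  module

theorem aux1 {F M : Type*} [Field F] [AddCommGroup M] [Module F M] (a : F) (ha : a ≠ 0)
    (x y z : M) :
    (-a) • (a⁻¹ • x + (a - a⁻¹ ^ 3) • y) + a⁻¹ • a • z =
      a⁻¹ • (-a) • x + ((a⁻¹ - a ^ 3) • a⁻¹ • y + a • a⁻¹ • z) := by
  match_scalars <;> field_simp <;> ring

theorem q_ne_zero : q ≠ 0 := RatFunc.X_ne_zero

theorem VVbasis_apply (i j : Fin 2) : VVbasis (i, j) = e i ⊗ₜ[K] e j := by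
  simp [VVbasis, Vbasis, e, Module.Basis.tensorProduct_apply]

theorem NE_00 : NE (e 0 ⊗ₜ[K] e 0) = q • (e 0 ⊗ₜ[K] e 0) := by
  rw [← VVbasis_apply, NE, Module.Basis.constr_basis]; simp [VVbasis_apply]
theorem NE_11 : NE (e 1 ⊗ₜ[K] e 1) = q • (e 1 ⊗ₜ[K] e 1) := by
  rw [← VVbasis_apply, NE, Module.Basis.constr_basis]; simp [VVbasis_apply]
theorem NE_01 : NE (e 0 ⊗ₜ[K] e 1) = q⁻¹ • (e 1 ⊗ₜ[K] e 0) := by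
  rw [← VVbasis_apply 0 1, NE, Module.Basis.constr_basis]; simp [VVbasis_apply]
theorem NE_10 : NE (e 1 ⊗ₜ[K] e 0) =
    q⁻¹ • (e 0 ⊗ₜ[K] e 1) + (q - q⁻¹ ^ 3) • (e 1 ⊗ₜ[K] e 0) := by
  rw [← VVbasis_apply 1 0, NE, Module.Basis.constr_basis]; simp [VVbasis_apply]
theorem NW_00 : NW (e 0 ⊗ₜ[K] e 0) = q⁻¹ • (e 0 ⊗ₜ[K] e 0) := by
  rw [← VVbasis_apply, NW, Module.Basis.constr_basis]; simp [VVbasis_apply]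
theorem NW_11 : NW (e 1 ⊗ₜ[K] e 1) = q⁻¹ • (e 1 ⊗ₜ[K] e 1) := by
  rw [← VVbasis_apply, NW, Module.Basis.constr_basis]; simp [VVbasis_apply]
theorem NW_10 : NW (e 1 ⊗ₜ[K] e 0) = q • (e 0 ⊗ₜ[K] e 1) := by
  rw [← VVbasis_apply 1 0, NW, Module.Basis.constr_basis]; simp [VVbasis_apply]
theorem NW_01 : NW (e 0 ⊗ₜ[K] e 1) =
    (q⁻¹ - q ^ 3) • (e 0 ⊗ₜ[K] e 1) + q • (e 1 ⊗ₜ[K] e 0) := by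
  rw [← VVbasis_apply 0 1, NW, Module.Basis.constr_basis]; simp [VVbasis_apply]
theorem Cup_one : Cup 1 = (-q) • (e 0 ⊗ₜ[K] e 1) + q⁻¹ • (e 1 ⊗ₜ[K] e 0) := by
  rw [Cup, LinearMap.toSpanSingleton_apply, one_smul]

/-- Yetter Ψ move (ET4I):
`(⟨NE⟩ ⊗ id_V) ∘ (id_V ⊗ ⟨Cup⟩) = (id_V ⊗ ⟨NW⟩) ∘ (⟨Cup⟩ ⊗ id_V)` as maps `V → (V ⊗ V) ⊗ V`. -/
theorem yetter_psi_ET4I :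
    TensorProduct.map NE (LinearMap.id : V →ₗ[K] V) ∘ₗ
        (TensorProduct.assoc K V V V).symm.toLinearMap ∘ₗ
        TensorProduct.map (LinearMap.id : V →ₗ[K] V) Cup ∘ₗ
        (TensorProduct.rid K V).symm.toLinearMap
      =
      (TensorProduct.assoc K V V V).symm.toLinearMap ∘ₗ
        TensorProduct.map (LinearMap.id : V →ₗ[K] V) NW ∘ₗ
        (TensorProduct.assoc K V V V).toLinearMap ∘ₗ
        TensorProduct.map Cup (LinearMap.id : V →ₗ[K] V) ∘ₗ
        (TensorProduct.lid K V).symm.toLinearMap := by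
  apply Vbasis.ext
  intro i
  have hb : Vbasis i = e i := by simp [Vbasis, e]
  rw [hb]
  simp only [LinearMap.comp_apply, LinearEquiv.coe_coe, TensorProduct.rid_symm_apply,
    TensorProduct.lid_symm_apply, TensorProduct.map_tmul, LinearMap.id_apply, Cup_one,
    TensorProduct.tmul_add, TensorProduct.add_tmul, TensorProduct.tmul_smul,
    TensorProduct.smul_tmul', map_add, map_smul, TensorProduct.assoc_symm_tmul,
    TensorProduct.assoc_tmul]
  fin_cases i
  · simp only [Fin.zero_eta, NE_00, NE_01, NW_10, NW_00, TensorProduct.tmul_smul,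
      ← TensorProduct.smul_tmul', map_smul, map_add, TensorProduct.assoc_symm_tmul,
      TensorProduct.assoc_tmul, TensorProduct.map_tmul, LinearMap.id_apply]
    exact aux0 (F := K) (M := (V ⊗[K] V) ⊗[K] V) q ((e 0 ⊗ₜ[K] e 0) ⊗ₜ[K] e 1)
      ((e 1 ⊗ₜ[K] e 0) ⊗ₜ[K] e 0)
  · simp only [Fin.mk_one, NE_10, NE_11, NW_01, NW_11, TensorProduct.tmul_smul,
      ← TensorProduct.smul_tmul', map_smul, map_add, TensorProduct.assoc_symm_tmul,
      TensorProduct.add_tmul, TensorProduct.tmul_add,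
      TensorProduct.assoc_tmul, TensorProduct.map_tmul, LinearMap.id_apply]
    exact aux1 (F := K) (M := (V ⊗[K] V) ⊗[K] V) q q_ne_zero
      ((e 0 ⊗ₜ[K] e 1) ⊗ₜ[K] e 1) ((e 1 ⊗ₜ[K] e 0) ⊗ₜ[K] e 1)
      ((e 1 ⊗ₜ[K] e 1) ⊗ₜ[K] e 0)
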